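/- arXiv:cs/0607132 — 2 statements merged into one kernel-verified Lean document; each statement's English description precedes it below -/
import Mathlib

section
/- Let q ≥ 2 be an integer and ℓ ∈ {0,1,…,q−1}. Then lim_{n→∞} (A_u(n,ℓ)_q)^{1/n} = ⌈q/(ℓ+1)⌉. -/
open Finset Filter

/-- `x` is a word over the alphabet `Q = {0,1,…,q-1}`. -/
def inQ (q : ℤ) {n : ℕ} (x : Fin n → ℤ) : Prop :=
  ∀ i, 0 ≤ x i ∧ x i ≤ q - 1

/-- `d(x,y) = max_i |x_i - y_i|`. -/
def dmax {n : ℕ} (x y : Fin n → ℤ) : ℤ :=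
  ((Finset.univ.sup fun i => (x i - y i).natAbs : ℕ) : ℤ)

/-- `d_u(x,y)`: equals `d(x,y)` if `x ≥ y` or `y ≥ x`, and `2·d(x,y)` otherwise. -/
def du {n : ℕ} (x y : Fin n → ℤ) : ℤ :=
  if (∀ i, y i ≤ x i) ∨ (∀ i, x i ≤ y i) then dmax x y else 2 * dmax x y

/-- Maximum size of an `ℓ`-AEC code in `Q^n`. -/
noncomputable def Aa (q : ℤ) (n : ℕ) (ℓ : ℤ) : ℕ :=
  sSup {k : ℕ | ∃ C : Finset (Fin n → ℤ), (∀ x ∈ C, inQ q x) ∧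
    (∀ x ∈ C, ∀ y ∈ C, x ≠ y → ℓ + 1 ≤ dmax x y) ∧ C.card = k}

/-- Maximum size of an `ℓ`-UEC code in `Q^n`. -/
noncomputable def Au (q : ℤ) (n : ℕ) (ℓ : ℤ) : ℕ :=
  sSup {k : ℕ | ∃ C : Finset (Fin n → ℤ), (∀ x ∈ C, inQ q x) ∧
    (∀ x ∈ C, ∀ y ∈ C, x ≠ y → 2 * ℓ + 1 ≤ du x y) ∧ C.card = k}

/-- `C` is a code of Varshamov–Tenengolts type: the solution set in `Q^n`
of a linear equation `Σ aᵢ xᵢ = a` over `ℤ`. -/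
def IsVT (q : ℤ) {n : ℕ} (C : Finset (Fin n → ℤ)) : Prop :=
  ∃ (coef : Fin n → ℤ) (a : ℤ),
    ∀ x : Fin n → ℤ, x ∈ C ↔ (inQ q x ∧ ∑ i, coef i * x i = a)

/-- Maximum size of a VT-type `ℓ`-AEC code in `Q^n`. -/
noncomputable def LAa (q : ℤ) (n : ℕ) (ℓ : ℤ) : ℕ :=
  sSup {k : ℕ | ∃ C : Finset (Fin n → ℤ), IsVT q C ∧
    (∀ x ∈ C, ∀ y ∈ C, x ≠ y → ℓ + 1 ≤ dmax x y) ∧ C.card = k}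

/-- Maximum size of a VT-type `ℓ`-UEC code in `Q^n`. -/
noncomputable def LAu (q : ℤ) (n : ℕ) (ℓ : ℤ) : ℕ :=
  sSup {k : ℕ | ∃ C : Finset (Fin n → ℤ), IsVT q C ∧
    (∀ x ∈ C, ∀ y ∈ C, x ≠ y → 2 * ℓ + 1 ≤ du x y) ∧ C.card = k}

/-- `γ_n(r) = |C_n(r)|` where
`C_n(r) = {x ∈ Q^n : Σ (ℓ+1)^i x_i = α·S_n + r}`, `α = ⌊(q-1)/2⌋`,
`S_n = Σ_{i<n} (ℓ+1)^i`. -/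
noncomputable def gam (q ℓ : ℤ) (n : ℕ) (r : ℤ) : ℕ :=
  Set.ncard {x : Fin n → ℤ | inQ q x ∧
    ∑ i : Fin n, (ℓ + 1) ^ (i : ℕ) * x i
      = ((q - 1) / 2) * (∑ i ∈ Finset.range n, (ℓ + 1) ^ i) + r}

lemma dmax_le_iff {n : ℕ} (x y : Fin n → ℤ) (ℓ : ℤ) (hℓ : 0 ≤ ℓ) :
    dmax x y ≤ ℓ ↔ ∀ i, |x i - y i| ≤ ℓ := by
  lift ℓ to ℕ using hℓ
  simp only [dmax, Nat.cast_le, Finset.sup_le_iff, Finset.mem_univ, true_imp_iff]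
  refine forall_congr' fun i => ?_
  rw [Int.abs_eq_natAbs, Nat.cast_le]

/-- A code with large `d_u`-distance has at most one word in each box of side `ℓ + 1`. -/
lemma card_le_pow_of_du {q ℓ : ℤ} {c n : ℕ} (hℓ : 0 ≤ ℓ) (hc : q ≤ c * (ℓ + 1))
    (C : Finset (Fin n → ℤ)) (hCq : ∀ x ∈ C, inQ q x)
    (hC : ∀ x ∈ C, ∀ y ∈ C, x ≠ y → 2 * ℓ + 1 ≤ du x y) : C.card ≤ c ^ n := by
  have hm : 0 < ℓ + 1 := by omega
  have hcard : (Fintype.piFinset fun _ : Fin n => Finset.Ico (0 : ℤ) c).card = c ^ n := by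
    simp
  rw [← hcard]
  refine Finset.card_le_card_of_injOn (fun x i => x i / (ℓ + 1)) ?_ ?_
  · intro x hx
    simp only [Finset.mem_coe, Fintype.mem_piFinset, Finset.mem_Ico]
    intro i
    obtain ⟨h0, h1⟩ := hCq x hx i
    exact ⟨Int.ediv_nonneg h0 hm.le, Int.ediv_lt_of_lt_mul hm (by omega)⟩
  · intro x hx y hy hxy
    by_contra hne
    have hd : dmax x y ≤ ℓ := by
      rw [dmax_le_iff x y ℓ hℓ]
      intro i
      have hi : x i / (ℓ + 1) = y i / (ℓ + 1) := congrFun hxy i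
      have hx1 := Int.mul_ediv_add_emod (x i) (ℓ + 1)
      have hy1 := Int.mul_ediv_add_emod (y i) (ℓ + 1)
      have hx2 := Int.emod_nonneg (x i) hm.ne'
      have hy2 := Int.emod_nonneg (y i) hm.ne'
      have hx3 := Int.emod_lt_of_pos (x i) hm
      have hy3 := Int.emod_lt_of_pos (y i) hm
      rw [hi] at hx1
      rw [abs_le]
      constructor <;> linarith
    have h := hC x hx y hy hne
    have hd0 : 0 ≤ dmax x y := Int.natCast_nonneg _
    unfold du at h
    split_ifs at h <;> omega

lemma Au_le_pow {q ℓ : ℤ} {c : ℕ} (n : ℕ) (hℓ : 0 ≤ ℓ) (hc : q ≤ c * (ℓ + 1)) :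
    Au q n ℓ ≤ c ^ n := by
  refine csSup_le' ?_
  rintro k ⟨C, hCq, hC, rfl⟩
  exact card_le_pow_of_du hℓ hc C hCq hC

lemma card_le_Au {q ℓ : ℤ} {c n : ℕ} (hℓ : 0 ≤ ℓ) (hc : q ≤ c * (ℓ + 1))
    (C : Finset (Fin n → ℤ)) (hCq : ∀ x ∈ C, inQ q x)
    (hC : ∀ x ∈ C, ∀ y ∈ C, x ≠ y → 2 * ℓ + 1 ≤ du x y) : C.card ≤ Au q n ℓ := by
  refine le_csSup ⟨c ^ n, ?_⟩ ⟨C, hCq, hC, rfl⟩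
  rintro k ⟨D, hDq, hD, rfl⟩
  exact card_le_pow_of_du hℓ hc D hDq hD

/-- Distinct multiples of `ℓ + 1` with equal coordinate sums are incomparable and far apart. -/
lemma le_du_of_sum_eq {ℓ : ℤ} {n : ℕ} (hℓ : 0 ≤ ℓ) (u v : Fin n → ℕ) (huv : u ≠ v)
    (hsum : ∑ i, u i = ∑ i, v i) :
    2 * ℓ + 1 ≤ du (fun i => (ℓ + 1) * (u i : ℤ)) (fun i => (ℓ + 1) * (v i : ℤ)) := by
  have hm : 0 < ℓ + 1 := by omega
  have hle : ∀ a b : Fin n → ℕ, ∑ i, a i = ∑ i, b i →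
      (∀ i, (ℓ + 1) * (a i : ℤ) ≤ (ℓ + 1) * (b i : ℤ)) → a = b := by
    intro a b hab h
    have h' : ∀ i ∈ Finset.univ, a i ≤ b i := fun i _ => by
      exact_mod_cast le_of_mul_le_mul_left (h i) hm
    funext i
    exact (Finset.sum_eq_sum_iff_of_le h').1 hab i (Finset.mem_univ i)
  have hinc : ¬ ((∀ i, (ℓ + 1) * (v i : ℤ) ≤ (ℓ + 1) * (u i : ℤ)) ∨
      ∀ i, (ℓ + 1) * (u i : ℤ) ≤ (ℓ + 1) * (v i : ℤ)) := by
    rintro (h | h)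
    · exact huv (hle v u hsum.symm h).symm
    · exact huv (hle u v hsum h)
  unfold du
  rw [if_neg hinc]
  by_contra! hlt
  have hd := (dmax_le_iff _ _ ℓ hℓ).1 (show dmax (fun i => (ℓ + 1) * (u i : ℤ))
    (fun i => (ℓ + 1) * (v i : ℤ)) ≤ ℓ by omega)
  refine huv (funext fun i => ?_)
  have hi := hd i
  simp only [← mul_sub, abs_mul, abs_of_pos hm] at hi
  have h1 : |(u i : ℤ) - v i| < 1 := by
    by_contra! hge
    nlinarith
  have := Int.abs_lt_one_iff.1 h1
  omega

lemma pow_le_Au_mul {q ℓ : ℤ} {c : ℕ} (n : ℕ) (hℓ : 0 ≤ ℓ) (hc : q ≤ c * (ℓ + 1))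
    (hc' : ((c : ℤ) - 1) * (ℓ + 1) < q) : c ^ n ≤ Au q n ℓ * (n * c + 1) := by
  have hm : 0 < ℓ + 1 := by omega
  set S := Fintype.piFinset fun _ : Fin n => Finset.range c with hS
  have hScard : S.card = c ^ n := by simp [hS]
  have hmem : ∀ u ∈ S, ∀ i, u i < c := fun u hu i => by
    simpa using Fintype.mem_piFinset.1 hu i
  have hinj : Function.Injective fun (u : Fin n → ℕ) (i : Fin n) => (ℓ + 1) * (u i : ℤ) := by
    intro u v h
    funext i
    exact_mod_cast mul_left_cancel₀ hm.ne' (congrFun h i)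
  have key := Finset.card_le_mul_card_image_of_maps_to (s := S) (t := Finset.range (n * c + 1))
    (f := fun u => ∑ i, u i) (fun u hu => by
      have : ∑ i, u i ≤ ∑ _i : Fin n, c := Finset.sum_le_sum fun i _ => (hmem u hu i).le
      simp at this ⊢
      omega) (Au q n ℓ) (fun b _ => by
      rw [← Finset.card_image_of_injective _ hinj]
      refine card_le_Au hℓ hc _ ?_ ?_
      · intro x hx
        obtain ⟨u, hu, rfl⟩ := Finset.mem_image.1 hx
        intro i
        have hui : (u i : ℤ) ≤ c - 1 := by
          have := hmem u (Finset.mem_filter.1 hu).1 i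
          omega
        refine ⟨by positivity, ?_⟩
        have := mul_le_mul_of_nonneg_left hui hm.le
        change (ℓ + 1) * (u i : ℤ) ≤ q - 1
        linarith
      · intro x hx y hy hxy
        obtain ⟨u, hu, rfl⟩ := Finset.mem_image.1 hx
        obtain ⟨v, hv, rfl⟩ := Finset.mem_image.1 hy
        refine le_du_of_sum_eq hℓ u v (fun h => hxy (by rw [h])) ?_
        exact (Finset.mem_filter.1 hu).2.trans (Finset.mem_filter.1 hv).2.symm)
  rwa [hScard, Finset.card_range] at key

lemma tendsto_mul_add_one_rpow_one_div (c : ℕ) :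
    Tendsto (fun n : ℕ => ((n * c + 1 : ℕ) : ℝ) ^ (1 / (n : ℝ))) atTop (nhds 1) := by
  have h1 : Tendsto (fun n : ℕ => (n : ℝ) ^ (1 / (n : ℝ))) atTop (nhds 1) :=
    tendsto_rpow_div.comp tendsto_natCast_atTop_atTop
  have h2 : Tendsto (fun n : ℕ => ((c : ℝ) + 1) ^ (1 / (n : ℝ))) atTop (nhds 1) := by
    have := (tendsto_const_nhds (x := (c : ℝ) + 1)).rpow tendsto_one_div_atTop_nhds_zero_nat
      (Or.inl (by positivity))
    simpa using this
  have h3 := h1.mul h2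
  rw [one_mul] at h3
  refine tendsto_of_tendsto_of_tendsto_of_le_of_le' tendsto_const_nhds h3 ?_ ?_
  · filter_upwards with n
    exact Real.one_le_rpow (by push_cast; nlinarith [(by positivity : (0 : ℝ) ≤ n * c)])
      (by positivity)
  · filter_upwards [eventually_ge_atTop 1] with n hn
    rw [← Real.mul_rpow (by positivity) (by positivity)]
    refine Real.rpow_le_rpow (by positivity) ?_ (by positivity)
    have : (1 : ℝ) ≤ n := by exact_mod_cast hn
    push_cast
    linarith

lemma tendsto_rpow_one_div_of_le_pow {a : ℕ → ℕ} {c : ℕ}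
    (hle : ∀ n, a n ≤ c ^ n) (hge : ∀ n, c ^ n ≤ a n * (n * c + 1)) :
    Tendsto (fun n : ℕ => (a n : ℝ) ^ (1 / (n : ℝ))) atTop (nhds (c : ℝ)) := by
  have hroot : ∀ n : ℕ, 1 ≤ n → ((c : ℝ) ^ n) ^ (1 / (n : ℝ)) = c := fun n hn => by
    rw [one_div, Real.pow_rpow_inv_natCast (by positivity) (by omega)]
  have hlow : Tendsto (fun n : ℕ => (c : ℝ) / ((n * c + 1 : ℕ) : ℝ) ^ (1 / (n : ℝ)))
      atTop (nhds (c : ℝ)) := by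
    have h := (tendsto_const_nhds (x := (c : ℝ))).div (tendsto_mul_add_one_rpow_one_div c)
      one_ne_zero
    rwa [div_one] at h
  refine tendsto_of_tendsto_of_tendsto_of_le_of_le' hlow tendsto_const_nhds ?_ ?_
  · filter_upwards [eventually_ge_atTop 1] with n hn
    rw [div_le_iff₀ (Real.rpow_pos_of_pos (by positivity) _),
      ← Real.mul_rpow (by positivity) (by positivity)]
    calc (c : ℝ) = ((c : ℝ) ^ n) ^ (1 / (n : ℝ)) := (hroot n hn).symm
      _ ≤ _ := Real.rpow_le_rpow (by positivity) (by exact_mod_cast hge n) (by positivity)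
  · filter_upwards [eventually_ge_atTop 1] with n hn
    calc (a n : ℝ) ^ (1 / (n : ℝ)) ≤ ((c : ℝ) ^ n) ^ (1 / (n : ℝ)) :=
          Real.rpow_le_rpow (by positivity) (by exact_mod_cast hle n) (by positivity)
      _ = c := hroot n hn

/-- `lim_{n→∞} (A_u(n,ℓ)_q)^{1/n} = ⌈q/(ℓ+1)⌉`. -/
theorem stmt7 (q : ℤ) (hq : 2 ≤ q) (ℓ : ℤ) (hℓ0 : 0 ≤ ℓ) (hℓq : ℓ ≤ q - 1) :
    Filter.Tendsto (fun n : ℕ => (Au q n ℓ : ℝ) ^ (1 / (n : ℝ)))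
      Filter.atTop (nhds ((⌈(q : ℚ) / ((ℓ : ℚ) + 1)⌉ : ℤ) : ℝ)) := by
  have hm : (0 : ℚ) < (ℓ : ℚ) + 1 := by exact_mod_cast (by omega : 0 < ℓ + 1)
  have hq0 : (0 : ℚ) ≤ q := by exact_mod_cast (by omega : 0 ≤ q)
  have hle := Int.le_ceil ((q : ℚ) / ((ℓ : ℚ) + 1))
  have hlt := Int.ceil_lt_add_one ((q : ℚ) / ((ℓ : ℚ) + 1))
  have hnonneg : 0 ≤ ⌈(q : ℚ) / ((ℓ : ℚ) + 1)⌉ := Int.ceil_nonneg (div_nonneg hq0 hm.le)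
  obtain ⟨c, hc⟩ := Int.eq_ofNat_of_zero_le hnonneg
  rw [hc] at hle hlt ⊢
  rw [div_le_iff₀ hm] at hle
  rw [← sub_lt_iff_lt_add, lt_div_iff₀ hm] at hlt
  have h1 : q ≤ c * (ℓ + 1) := by exact_mod_cast hle
  have h2 : ((c : ℤ) - 1) * (ℓ + 1) < q := by exact_mod_cast hlt
  rw [Int.cast_natCast]
  exact tendsto_rpow_one_div_of_le_pow (fun n => Au_le_pow n hℓ0 h1)
    fun n => pow_le_Au_mul n hℓ0 h1 h2
end

section
/- Let q ≥ 2 and ℓ ≥ 1 be integers such that ℓ+1 divides q, and let α = ⌊(q−1)/2⌋. Define u_1 = −α, v_1 = α, and for n ≥ 2, u_n = (ℓ+1)u_{n−1} + α and v_n = (ℓ+1)v_{n−1} − α. Then for every n ≥ 1 and every integer r with u_n ≤ r ≤ v_n, γ_n(r) = (q/(ℓ+1))^{n−1}, and moreover LA_u(n,ℓ)_q = (q/(ℓ+1))^{n−1}. -/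
open Finset Filter

lemma dmax_le {n : ℕ} {x y : Fin n → ℤ} {b : ℤ} (hb : 0 ≤ b) (h : ∀ i, |x i - y i| ≤ b) :
    dmax x y ≤ b := by
  lift b to ℕ using hb
  unfold dmax
  norm_cast
  refine Finset.sup_le fun i _ => ?_
  have := h i
  rw [Int.abs_eq_natAbs] at this
  exact_mod_cast this

lemma abs_sub_le_dmax {n : ℕ} (x y : Fin n → ℤ) (i : Fin n) : |x i - y i| ≤ dmax x y := by
  rw [Int.abs_eq_natAbs]
  unfold dmax
  exact_mod_cast Finset.le_sup (f := fun i => (x i - y i).natAbs) (Finset.mem_univ i)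

lemma du_le {n : ℕ} {x y : Fin n → ℤ} {b : ℤ} (hb : 0 ≤ b) (h : ∀ i, |x i - y i| ≤ b) :
    du x y ≤ 2 * b := by
  have := dmax_le hb h
  unfold du
  split_ifs <;> omega

/-- The solution set in `Q^n` of the equation `∑ i, coef i * x i = a`. -/
noncomputable def vtCode (q : ℤ) {n : ℕ} (coef : Fin n → ℤ) (a : ℤ) : Finset (Fin n → ℤ) :=
  (Fintype.piFinset fun _ => Finset.Icc 0 (q - 1)).filter fun x => ∑ i, coef i * x i = a

lemma mem_vtCode {q : ℤ} {n : ℕ} {coef : Fin n → ℤ} {a : ℤ} {x : Fin n → ℤ} :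
    x ∈ vtCode q coef a ↔ inQ q x ∧ ∑ i, coef i * x i = a := by
  simp [vtCode, inQ]

lemma gam_eq_card_vtCode (q ℓ : ℤ) (n : ℕ) (r : ℤ) :
    gam q ℓ n r = (vtCode q (fun i : Fin n => (ℓ + 1) ^ (i : ℕ))
      ((q - 1) / 2 * (∑ i ∈ Finset.range n, (ℓ + 1) ^ i) + r)).card := by
  rw [gam, ← Set.ncard_coe_finset]
  congr 1
  ext x
  simp [mem_vtCode]

/-- Two words of a VT-type `ℓ`-UEC code that agree modulo `k` are equal. -/
lemma eq_of_modEq_of_isVT {ℓ : ℤ} {k n : ℕ} (hk : 0 < k) (hℓ : 1 ≤ ℓ) {C : Finset (Fin n → ℤ)}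
    (hvt : IsVT ((ℓ + 1) * k) C) (hC : ∀ x ∈ C, ∀ y ∈ C, x ≠ y → 2 * ℓ + 1 ≤ du x y)
    {x y : Fin n → ℤ} (hx : x ∈ C) (hy : y ∈ C) (h : ∀ i, (k : ℤ) ∣ x i - y i) : x = y := by
  obtain ⟨coef, a, hmem⟩ := hvt
  choose z hz using h
  have hk' : (1 : ℤ) ≤ k := by exact_mod_cast hk
  obtain ⟨hxQ, hxa⟩ := (hmem x).1 hx
  obtain ⟨hyQ, hya⟩ := (hmem y).1 hy
  have hzl : ∀ i, |z i| ≤ ℓ := by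
    intro i
    have h1 := hxQ i
    have h2 := hyQ i
    have h3 := hz i
    rw [abs_le]
    constructor
    · by_contra! hlt
      nlinarith
    · by_contra! hlt
      nlinarith
  have hwQ : inQ ((ℓ + 1) * k) (y + z) := by
    intro i
    have h1 := hxQ i
    have h2 := hyQ i
    have h3 := hz i
    rw [Pi.add_apply]
    rcases le_total 0 (z i) with h0 | h0
    · exact ⟨by linarith, by nlinarith⟩
    · exact ⟨by nlinarith, by linarith⟩
  have hz0 : ∑ i, coef i * z i = 0 := by
    have h1 : (k : ℤ) * ∑ i, coef i * z i = ∑ i, coef i * x i - ∑ i, coef i * y i := by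
      rw [← Finset.sum_sub_distrib, Finset.mul_sum]
      refine Finset.sum_congr rfl fun i _ => ?_
      rw [← mul_sub, hz i]
      ring
    rw [hxa, hya, sub_self] at h1
    exact (mul_eq_zero.1 h1).resolve_left (by positivity)
  have hw : y + z ∈ C := by
    refine (hmem _).2 ⟨hwQ, ?_⟩
    simp only [Pi.add_apply, mul_add, Finset.sum_add_distrib, hya, hz0, add_zero]
  have hyz : y + z = y := by
    by_contra hne
    have h1 := hC _ hw _ hy hne
    have h2 : du (y + z) y ≤ 2 * ℓ := du_le (by omega) fun i => by simpa using hzl i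
    omega
  have hz_eq : z = 0 := by simpa using hyz
  funext i
  have := hz i
  rw [hz_eq] at this
  simpa [sub_eq_zero] using this

/-- Integer points on a primitive hyperplane that are pairwise incongruent modulo `k`
number at most `k ^ (n - 1)`. -/
lemma card_mul_le_pow_of_residues {k n : ℕ} [NeZero k] {C : Finset (Fin n → ℤ)}
    {g : Fin n → ℤ} {b : ℤ} {c : Fin n → ℤ} (hc : ∑ i, g i * c i = 1)
    (hCb : ∀ x ∈ C, ∑ i, g i * x i = b)
    (hinj : ∀ x ∈ C, ∀ y ∈ C, (∀ i, (k : ℤ) ∣ x i - y i) → x = y) :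
    C.card * k ≤ k ^ n := by
  have hcard : (C ×ˢ (Finset.univ : Finset (ZMod k))).card
      ≤ (Finset.univ : Finset (Fin n → ZMod k)).card := by
    refine Finset.card_le_card_of_injOn (fun p i => (p.1 i : ZMod k) + p.2 * (c i : ZMod k))
      (fun _ _ => Finset.mem_coe.2 (Finset.mem_univ _)) ?_
    rintro ⟨x, s⟩ hx ⟨y, t⟩ hy heq
    have hxC : x ∈ C := (Finset.mem_product.1 hx).1
    have hyC : y ∈ C := (Finset.mem_product.1 hy).1
    have hval : ∀ x ∈ C, ∀ s : ZMod k,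
        ∑ i, (g i : ZMod k) * ((x i : ZMod k) + s * (c i : ZMod k)) = b + s := by
      intro x hx s
      have h1 := congrArg (Int.cast : ℤ → ZMod k) (hCb x hx)
      have h2 := congrArg (Int.cast : ℤ → ZMod k) hc
      push_cast at h1 h2
      simp only [mul_add, Finset.sum_add_distrib, mul_left_comm _ s, ← Finset.mul_sum, h1, h2,
        mul_one]
    have hfun : ∀ i, (x i : ZMod k) + s * (c i : ZMod k) = (y i : ZMod k) + t * (c i : ZMod k) :=
      fun i => congrFun heq i
    have hst : s = t := by
      have h1 := hval x hxC s
      simp only [hfun] at h1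
      rw [hval y hyC t] at h1
      exact (add_left_cancel h1).symm
    subst hst
    have hxy : x = y := hinj x hxC y hyC fun i =>
      (ZMod.intCast_eq_intCast_iff_dvd_sub _ _ _).1 (add_right_cancel (hfun i)).symm
    rw [hxy]
  simpa [Finset.card_product, ZMod.card] using hcard

lemma card_le_of_isVT {ℓ : ℤ} {k n : ℕ} (hk : 0 < k) (hℓ : 1 ≤ ℓ)
    {C : Finset (Fin (n + 1) → ℤ)} (hvt : IsVT ((ℓ + 1) * k) C)
    (hC : ∀ x ∈ C, ∀ y ∈ C, x ≠ y → 2 * ℓ + 1 ≤ du x y) : C.card ≤ k ^ n := by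
  have : NeZero k := ⟨hk.ne'⟩
  rcases C.eq_empty_or_nonempty with rfl | ⟨x₀, hx₀⟩
  · simp
  have hinj : ∀ x ∈ C, ∀ y ∈ C, (∀ i, (k : ℤ) ∣ x i - y i) → x = y :=
    fun x hx y hy h => eq_of_modEq_of_isVT hk hℓ hvt hC hx hy h
  obtain ⟨coef, a, hmem⟩ := hvt
  obtain ⟨g, hg, hg1⟩ := Finset.extract_gcd coef (Finset.univ_nonempty (α := Fin (n + 1)))
  obtain ⟨c, hc⟩ := Finset.gcd_eq_sum_mul Finset.univ g
  have hsum : ∀ x ∈ C, Finset.univ.gcd coef * ∑ i, g i * x i = a := by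
    intro x hx
    rw [← ((hmem x).1 hx).2, Finset.mul_sum]
    refine Finset.sum_congr rfl fun i hi => ?_
    rw [hg i hi]
    ring
  by_cases hd : Finset.univ.gcd coef = 0
  · exfalso
    have hcoef : ∀ i, coef i = 0 := fun i => Finset.gcd_eq_zero_iff.1 hd i (Finset.mem_univ i)
    have ha : a = 0 := by rw [← hsum x₀ hx₀, hd, zero_mul]
    have hk' : (1 : ℤ) ≤ k := by exact_mod_cast hk
    have h0 : (0 : Fin (n + 1) → ℤ) ∈ C :=
      (hmem _).2 ⟨fun i => ⟨le_rfl, by simp only [Pi.zero_apply]; nlinarith⟩, by simp [ha]⟩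
    have h1 : (1 : Fin (n + 1) → ℤ) ∈ C :=
      (hmem _).2 ⟨fun i => ⟨by simp, by simp only [Pi.one_apply]; nlinarith⟩, by simp [ha, hcoef]⟩
    have h2 := hC _ h1 _ h0 one_ne_zero
    have h3 : du (1 : Fin (n + 1) → ℤ) 0 ≤ 2 * 1 := du_le zero_le_one fun i => by simp
    omega
  · have hcard := card_mul_le_pow_of_residues (k := k) (C := C) (g := g)
      (b := ∑ i, g i * x₀ i) (c := c) (by rw [← hg1, hc])
      (fun x hx => mul_left_cancel₀ hd ((hsum x hx).trans (hsum x₀ hx₀).symm)) hinj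
    rw [pow_succ] at hcard
    exact Nat.le_of_mul_le_mul_right hcard hk

lemma eq_zero_of_sum_pow_mul_eq_zero {m : ℤ} :
    ∀ {n : ℕ} {z : Fin n → ℤ}, (∀ i, |z i| < m) → ∑ i : Fin n, m ^ (i : ℕ) * z i = 0 →
      ∀ i, z i = 0
  | 0, _, _, _ => fun i => i.elim0
  | n + 1, z, hz, hsum => by
    have hm : m ≠ 0 := ((abs_nonneg _).trans_lt (hz 0)).ne'
    have htail : ∑ i : Fin (n + 1), m ^ (i : ℕ) * z i
        = z 0 + m * ∑ i : Fin n, m ^ (i : ℕ) * z i.succ := by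
      rw [Fin.sum_univ_succ, Finset.mul_sum]
      congr 1
      · simp
      · refine Finset.sum_congr rfl fun i _ => ?_
        rw [Fin.val_succ, pow_succ]
        ring
    rw [htail] at hsum
    have h0 : z 0 = 0 := Int.eq_zero_of_abs_lt_dvd ⟨-∑ i : Fin n, m ^ (i : ℕ) * z i.succ, by linarith⟩ (hz 0)
    have hrest : ∑ i : Fin n, m ^ (i : ℕ) * z i.succ = 0 := by
      rw [h0, zero_add] at hsum
      exact (mul_eq_zero.1 hsum).resolve_left hm
    exact fun i => Fin.cases h0
      (eq_zero_of_sum_pow_mul_eq_zero (z := fun i => z i.succ) (fun i => hz i.succ) hrest) i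

lemma le_du_of_mem_vtCode_pow {q ℓ a : ℤ} (hℓ : 1 ≤ ℓ) {n : ℕ} {x y : Fin n → ℤ}
    (hx : x ∈ vtCode q (fun i : Fin n => (ℓ + 1) ^ (i : ℕ)) a)
    (hy : y ∈ vtCode q (fun i : Fin n => (ℓ + 1) ^ (i : ℕ)) a) (hne : x ≠ y) :
    2 * ℓ + 1 ≤ du x y := by
  have hpos : ∀ i : ℕ, 0 < (ℓ + 1) ^ i := fun i => pow_pos (by omega) i
  have hxa := (mem_vtCode.1 hx).2
  have hya := (mem_vtCode.1 hy).2
  have anti : ∀ {x y : Fin n → ℤ}, ∑ i : Fin n, (ℓ + 1) ^ (i : ℕ) * x i = a →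
      ∑ i : Fin n, (ℓ + 1) ^ (i : ℕ) * y i = a → (∀ i, x i ≤ y i) → x = y := by
    intro x y hx hy hle
    have h := (Finset.sum_eq_sum_iff_of_le fun i _ =>
      mul_le_mul_of_nonneg_left (hle i) (hpos i).le).1 (hx.trans hy.symm)
    exact funext fun i => mul_left_cancel₀ (hpos i).ne' (h i (Finset.mem_univ i))
  have hd : ℓ + 1 ≤ dmax x y := by
    by_contra! hlt
    refine hne (funext fun i => sub_eq_zero.1 ?_)
    refine eq_zero_of_sum_pow_mul_eq_zero (m := ℓ + 1) (z := fun i => x i - y i)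
      (fun i => (abs_sub_le_dmax x y i).trans_lt hlt) ?_ i
    simp only [mul_sub, Finset.sum_sub_distrib, hxa, hya, sub_self]
  unfold du
  rw [if_neg]
  · omega
  · rintro (h | h)
    · exact hne (anti hya hxa h).symm
    · exact hne (anti hxa hya h)

/-- The words of `vtCode` with base-`m` coefficients whose first coordinate lies in a given
length-`m` block correspond to the words of a code one dimension lower. -/
lemma card_filter_block_vtCode_pow {m k j b : ℤ} (hm : 2 ≤ m) (hj : 0 ≤ j) (hjk : j < k) (n : ℕ) :
    ((vtCode (m * k) (fun i : Fin (n + 1) => m ^ (i : ℕ)) b).filter fun x => x 0 / m = j).card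
      = (vtCode (m * k) (fun i : Fin n => m ^ (i : ℕ)) ((b - (b % m + m * j)) / m)).card := by
  have hm0 : m ≠ 0 := by omega
  have hsum : ∀ x : Fin (n + 1) → ℤ, ∑ i : Fin (n + 1), m ^ (i : ℕ) * x i
      = x 0 + m * ∑ i : Fin n, m ^ (i : ℕ) * Fin.tail x i := by
    intro x
    rw [Fin.sum_univ_succ, Finset.mul_sum]
    congr 1
    · simp
    · refine Finset.sum_congr rfl fun i _ => ?_
      rw [Fin.val_succ, pow_succ, Fin.tail]
      ring
  have hdiv : (b - (b % m + m * j)) / m = b / m - j := by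
    have h1 := Int.mul_ediv_add_emod b m
    rw [show b - (b % m + m * j) = m * (b / m - j) by linarith,
      Int.mul_ediv_cancel_left _ hm0]
  have hmod0 := Int.emod_nonneg b hm0
  have hmodlt := Int.emod_lt_of_pos b (show 0 < m by omega)
  rw [hdiv]
  refine Finset.card_nbij' Fin.tail (fun y => Fin.cons (b % m + m * j) y) ?_ ?_ ?_ ?_
  all_goals
    intro x hx
    simp only [Finset.coe_filter, Set.mem_ofPred_eq, Finset.mem_coe, mem_vtCode, hsum] at hx ⊢
  · obtain ⟨⟨hxQ, hxb⟩, hx0⟩ := hx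
    refine ⟨fun i => hxQ i.succ, ?_⟩
    have h1 : b / m = x 0 / m + ∑ i : Fin n, m ^ (i : ℕ) * Fin.tail x i := by
      rw [← hxb, Int.add_mul_ediv_left _ _ hm0]
    rw [h1, hx0]
    ring
  · obtain ⟨hxQ, hxb⟩ := hx
    have hmj0 : 0 ≤ m * j := by nlinarith
    have hmj : m * j + m ≤ m * k := by nlinarith
    have h0 : 0 ≤ b % m + m * j ∧ b % m + m * j ≤ m * k - 1 := ⟨by linarith, by omega⟩
    refine ⟨⟨fun i => Fin.cases (by simpa using h0) (fun i => by simpa using hxQ i) i, ?_⟩, ?_⟩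
    · rw [Fin.cons_zero, Fin.tail_cons, hxb]
      linarith [Int.mul_ediv_add_emod b m]
    · rw [Fin.cons_zero, Int.add_mul_ediv_left _ _ hm0, Int.ediv_eq_zero_of_lt hmod0 hmodlt,
        zero_add]
  · obtain ⟨⟨hxQ, hxb⟩, hx0⟩ := hx
    have h1 : b % m + m * j = x 0 := by
      rw [← hxb, Int.add_mul_emod_self_left, ← hx0, Int.emod_add_mul_ediv]
    rw [h1, Fin.cons_self_tail]
  · rw [Fin.tail_cons]

lemma card_vtCode_pow {m : ℤ} {k : ℕ} (hm : 2 ≤ m) {u v : ℕ → ℤ}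
    (hu1 : u 1 = -((m * k - 1) / 2)) (hv1 : v 1 = (m * k - 1) / 2)
    (hu : ∀ n : ℕ, 2 ≤ n → u n = m * u (n - 1) + (m * k - 1) / 2)
    (hv : ∀ n : ℕ, 2 ≤ n → v n = m * v (n - 1) - (m * k - 1) / 2) (n : ℕ) :
    ∀ r : ℤ, u (n + 1) ≤ r → r ≤ v (n + 1) →
      (vtCode (m * k) (fun i : Fin (n + 1) => m ^ (i : ℕ))
        ((m * k - 1) / 2 * (∑ i ∈ Finset.range (n + 1), m ^ i) + r)).card = k ^ n := by
  set α : ℤ := (m * k - 1) / 2 with hα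
  induction n with
  | zero =>
    intro r hur hrv
    rw [zero_add] at hur hrv
    rw [hu1] at hur
    rw [hv1] at hrv
    rw [pow_zero, Finset.card_eq_one]
    refine ⟨fun _ => α + r, ?_⟩
    ext x
    rw [mem_vtCode, Finset.mem_singleton]
    simp only [zero_add, Fin.sum_univ_succ, Fin.val_zero, pow_zero, one_mul,
      Finset.univ_eq_empty, Finset.sum_empty, add_zero, Finset.sum_range_one, mul_one]
    constructor
    · rintro ⟨-, h⟩
      funext i
      rw [Fin.fin_one_eq_zero i, h]
    · rintro rfl
      refine ⟨fun i => ⟨?_, ?_⟩, rfl⟩ <;> dsimp only <;> omega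
  | succ n ih =>
    intro r hur hrv
    have hm0 : m ≠ 0 := by omega
    rw [hu (n + 1 + 1) (by omega), Nat.add_sub_cancel] at hur
    rw [hv (n + 1 + 1) (by omega), Nat.add_sub_cancel] at hrv
    set b : ℤ := α * (∑ i ∈ Finset.range (n + 1 + 1), m ^ i) + r with hb
    have hbS : b = m * (α * ∑ i ∈ Finset.range (n + 1), m ^ i) + (α + r) := by
      rw [hb, Finset.sum_range_succ', pow_zero, Finset.sum_congr rfl fun i _ => pow_succ' m i,
        ← Finset.mul_sum]
      ring
    have hmaps : ∀ x ∈ vtCode (m * k) (fun i : Fin (n + 1 + 1) => m ^ (i : ℕ)) b,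
        x 0 / m ∈ Finset.Ico (0 : ℤ) k := by
      intro x hx
      have hx0 := (mem_vtCode.1 hx).1 0
      rw [Finset.mem_Ico]
      exact ⟨Int.ediv_nonneg hx0.1 (by omega), Int.ediv_lt_of_lt_mul (by omega) (by linarith)⟩
    rw [Finset.card_eq_sum_card_fiberwise hmaps, Finset.sum_congr rfl (g := fun _ => k ^ n)]
    · simp [pow_succ']
    intro j hj
    rw [Finset.mem_Ico] at hj
    rw [card_filter_block_vtCode_pow hm hj.1 hj.2]
    have hmod0 := Int.emod_nonneg b hm0
    have hmodlt := Int.emod_lt_of_pos b (show 0 < m by omega)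
    have hdiv := Int.mul_ediv_add_emod b m
    have hr' : (b - (b % m + m * j)) / m
        = α * (∑ i ∈ Finset.range (n + 1), m ^ i)
          + (b / m - j - α * ∑ i ∈ Finset.range (n + 1), m ^ i) := by
      rw [show b - (b % m + m * j) = m * (b / m - j) by linarith,
        Int.mul_ediv_cancel_left _ hm0]
      ring
    set s : ℤ := b / m - j - α * ∑ i ∈ Finset.range (n + 1), m ^ i with hs
    have hms : m * s = α + r - (b % m + m * j) := by
      rw [hs, mul_sub, mul_sub]
      linarith
    have hα2 : m * k - 1 ≤ 2 * α + 1 := by omega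
    have hmj : m * j + m ≤ m * k := by nlinarith
    have hmj0 : 0 ≤ m * j := by nlinarith
    rw [hr']
    apply ih
    · have : m * (u (n + 1) - 1) < m * s := by linarith
      have := lt_of_mul_lt_mul_left this (by omega)
      omega
    · exact le_of_mul_le_mul_left (by linarith : m * s ≤ m * v (n + 1)) (by omega)

/-- if `ℓ+1` divides `q`, `u_1 = -α`, `v_1 = α`,
`u_n = (ℓ+1)u_{n-1} + α`, `v_n = (ℓ+1)v_{n-1} - α` (with `α = ⌊(q-1)/2⌋`),
then for all `n ≥ 1` and `r ∈ [u_n, v_n]`,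
`γ_n(r) = (q/(ℓ+1))^{n-1}` and `LA_u(n,ℓ)_q = (q/(ℓ+1))^{n-1}`. -/
theorem stmt15 (q ℓ : ℤ) (hq : 2 ≤ q) (hℓ : 1 ≤ ℓ) (hdvd : (ℓ + 1) ∣ q)
    (u v : ℕ → ℤ)
    (hu1 : u 1 = -((q - 1) / 2)) (hv1 : v 1 = (q - 1) / 2)
    (hu : ∀ n : ℕ, 2 ≤ n → u n = (ℓ + 1) * u (n - 1) + (q - 1) / 2)
    (hv : ∀ n : ℕ, 2 ≤ n → v n = (ℓ + 1) * v (n - 1) - (q - 1) / 2) :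
    ∀ n : ℕ, 1 ≤ n → (∀ r : ℤ, u n ≤ r → r ≤ v n →
      (gam q ℓ n r : ℤ) = (q / (ℓ + 1)) ^ (n - 1)) ∧
      (LAu q n ℓ : ℤ) = (q / (ℓ + 1)) ^ (n - 1) := by
  intro n hn
  obtain ⟨n, rfl⟩ := Nat.exists_eq_add_of_le' hn
  obtain ⟨k, rfl⟩ := hdvd
  have hk : 0 < k := by
    by_contra! h
    nlinarith
  lift k to ℕ using hk.le
  have hk' : 0 < k := by exact_mod_cast hk
  rw [Int.mul_ediv_cancel_left _ (by omega : ℓ + 1 ≠ 0), Nat.add_sub_cancel]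
  have hcard := card_vtCode_pow (by omega : 2 ≤ ℓ + 1) hu1 hv1 hu hv n
  refine ⟨fun r hur hrv => ?_, ?_⟩
  · rw [gam_eq_card_vtCode, hcard r hur hrv, Nat.cast_pow]
  set α : ℤ := ((ℓ + 1) * k - 1) / 2 with hα
  have hα0 : 0 ≤ α := by omega
  have huv : ∀ n, u (n + 1) ≤ -α ∧ α ≤ v (n + 1) := by
    intro n
    induction n with
    | zero => exact ⟨hu1.le, hv1.ge⟩
    | succ n ih =>
      rw [hu (n + 1 + 1) (by omega), hv (n + 1 + 1) (by omega), Nat.add_sub_cancel]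
      constructor <;> nlinarith
  have hmax : IsGreatest {c : ℕ | ∃ C : Finset (Fin (n + 1) → ℤ), IsVT ((ℓ + 1) * k) C ∧
      (∀ x ∈ C, ∀ y ∈ C, x ≠ y → 2 * ℓ + 1 ≤ du x y) ∧ C.card = c} (k ^ n) := by
    constructor
    · exact ⟨_, ⟨_, _, fun x => mem_vtCode⟩, fun x hx y hy => le_du_of_mem_vtCode_pow hℓ hx hy,
        hcard 0 (by linarith [(huv n).1]) (by linarith [(huv n).2])⟩
    · rintro _ ⟨C, hvt, hC, rfl⟩
      exact card_le_of_isVT hk' hℓ hvt hC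
  rw [LAu, hmax.csSup_eq, Nat.cast_pow]
end
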